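/- Each of the complexes S^3_{8,35}, S^3_{8,36}, S^3_{8,37}, S^3_{8,38} is bistellar equivalent to the standard 3-sphere S^3_5 (hence each is a combinatorial 3-sphere). -/

import Mathlib

/-! Basic framework for finite simplicial complexes, pseudomanifolds and
bistellar moves, following Datta–Nilakantan. A complex is recorded as the
finite set of its faces (nonempty finite subsets of the vertex type). -/

namespace NPM

variable {α β : Type*} [DecidableEq α] [DecidableEq β]

/-- A "complex" datum: a finite family of finite subsets of `α`. -/
abbrev Complex (α : Type*) := Finset (Finset α)

/-- `K` is a simplicial complex: a nonempty collection of nonempty sets,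
closed under passing to nonempty subsets. -/
def IsComplex (K : Complex α) : Prop :=
  K.Nonempty ∧ (∀ σ ∈ K, σ.Nonempty) ∧ ∀ σ ∈ K, ∀ τ ⊆ σ, τ.Nonempty → τ ∈ K

/-- The vertex set of `K`. -/
def verts (K : Complex α) : Finset α := K.sup id

/-- `K` is pure of dimension `d`: every face is contained in a face with
`d+1` vertices. -/
def IsPure (K : Complex α) (d : ℕ) : Prop :=
  ∀ σ ∈ K, ∃ τ ∈ K, σ ⊆ τ ∧ τ.card = d + 1

/-- The facets ("`d`-faces") of a pure `d`-dimensional complex. -/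
def facets (K : Complex α) (d : ℕ) : Complex α := K.filter (fun σ => σ.card = d + 1)

/-- The link of a face `σ` in `K`. -/
def link (K : Complex α) (σ : Finset α) : Complex α :=
  K.filter (fun τ => Disjoint τ σ ∧ σ ∪ τ ∈ K)

/-- The degree of a face: the number of vertices of its link. -/
def degree (K : Complex α) (σ : Finset α) : ℕ := (verts (link K σ)).card

/-- A weak `d`-pseudomanifold: a pure `d`-dimensional complex in which every
`(d-1)`-face (i.e. face with `d` vertices) lies in exactly two facets. -/
def WeakPM (K : Complex α) (d : ℕ) : Prop :=
  IsComplex K ∧ IsPure K d ∧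
    ∀ σ ∈ K, σ.card = d → (K.filter fun τ => σ ⊆ τ ∧ τ.card = d + 1).card = 2

/-- Strong connectedness: any two facets are joined by a chain of facets in
which consecutive facets meet in a `(d-1)`-face. -/
def SConn (K : Complex α) (d : ℕ) : Prop :=
  ∀ σ ∈ facets K d, ∀ τ ∈ facets K d,
    Relation.ReflTransGen
      (fun a b => a ∈ facets K d ∧ b ∈ facets K d ∧ (a ∩ b).card = d) σ τ

/-- A `d`-pseudomanifold: a strongly connected weak `d`-pseudomanifold. -/
def IsPM (K : Complex α) (d : ℕ) : Prop := WeakPM K d ∧ SConn K d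

/-- Connectedness of a complex: the graph of vertices and edges is connected. -/
def Conn (K : Complex α) : Prop :=
  (verts K).Nonempty ∧ ∀ u ∈ verts K, ∀ v ∈ verts K,
    Relation.ReflTransGen (fun a b => a ≠ b ∧ ({a, b} : Finset α) ∈ K) u v

/-- A normal `d`-pseudomanifold: a connected weak `d`-pseudomanifold in which
the link of every face of dimension `≤ d - 2` is connected. -/
def NormalPM (K : Complex α) (d : ℕ) : Prop :=
  WeakPM K d ∧ Conn K ∧ ∀ σ ∈ K, σ.card + 1 ≤ d → Conn (link K σ)

/-- `K` is neighbourly: every pair of vertices forms an edge. -/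
def Neighbourly (K : Complex α) : Prop :=
  ∀ u ∈ verts K, ∀ v ∈ verts K, u ≠ v → ({u, v} : Finset α) ∈ K

/-- Isomorphism of complexes: a map injective on the vertex set carrying the
faces of `K` exactly onto the faces of `L`. -/
def Iso (K : Complex α) (L : Complex β) : Prop :=
  ∃ f : α → β, Set.InjOn f ↑(verts K) ∧ L = K.image (fun σ => σ.image f)

/-- The complex generated by a family of facets: all nonempty subsets. -/
def genCx (F : Finset (Finset α)) : Complex α :=
  F.biUnion fun σ => σ.powerset.filter (fun τ => τ.Nonempty)

/-- The standard sphere on the vertex set `B`: all nonempty proper subsets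
of `B`. -/
def stdSphere (B : Finset α) : Complex α :=
  B.powerset.filter fun τ => τ.Nonempty ∧ τ ≠ B

/-- In a weak `d`-pseudomanifold, a removable `(d-i)`-face `A`: its link is a
standard sphere `S^{i-1}_{i+1}(B)` with `B` not a face.  (For `d = 3`,
`i = 1` gives removable 2-faces and `i = 2` gives removable 1-faces.) -/
def RemovableFace (d i : ℕ) (K : Complex α) (A : Finset α) : Prop :=
  A ∈ K ∧ A.card = d - i + 1 ∧
    ∃ B : Finset α, B.card = i + 1 ∧ B ∉ K ∧ link K A = stdSphere B

/-- The bistellar `i`-move (`0 < i ≤ d`) relation on weak `d`-pseudomanifolds: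
`L` is obtained from `K` by removing a removable `(d-i)`-face `A` with
`link K A = stdSphere B` and inserting the facets `(B ∪ A) \ {v}`, `v ∈ A`. -/
def BMove (d i : ℕ) (K L : Complex α) : Prop :=
  ∃ A B : Finset α, A ∈ K ∧ A.card = d - i + 1 ∧ B.card = i + 1 ∧ B ∉ K ∧
    link K A = stdSphere B ∧
    L = genCx ((facets K d).filter (fun σ => ¬ A ⊆ σ) ∪
          A.image fun v => (B ∪ A).erase v)

/-- The bistellar `0`-move: star a new vertex `w` in a facet `σ`. -/
def BMove0 (d : ℕ) (K L : Complex α) : Prop :=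
  ∃ σ w, σ ∈ K ∧ σ.card = d + 1 ∧ w ∉ verts K ∧
    L = genCx (((facets K d).erase σ) ∪ σ.image fun v => insert w (σ.erase v))

/-- A single bistellar move of any type `0 ≤ i ≤ d`. -/
def BStep (d : ℕ) (K L : Complex α) : Prop :=
  BMove0 d K L ∨ ∃ i, 0 < i ∧ i ≤ d ∧ BMove d i K L

/-- Bistellar equivalence: a finite sequence of bistellar moves. -/
def BEquiv (d : ℕ) : Complex α → Complex α → Prop :=
  Relation.ReflTransGen (BStep d)

/-- A proper bistellar move: a bistellar `i`-move with `0 < i < d`. -/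
def PMove (d : ℕ) (K L : Complex α) : Prop := ∃ i, 0 < i ∧ i < d ∧ BMove d i K L

/-- Proper bistellar equivalence. -/
def PEquiv (d : ℕ) : Complex α → Complex α → Prop :=
  Relation.ReflTransGen (PMove d)

/-- The result of the bistellar move on the face `A` of the weak
`d`-pseudomanifold `K` (deterministic form: `B` is the vertex set of
`link K A`). -/
def kappa (d : ℕ) (K : Complex α) (A : Finset α) : Complex α :=
  genCx ((facets K d).filter (fun σ => ¬ A ⊆ σ) ∪
    A.image fun v => (verts (link K A) ∪ A).erase v)

/-- A cycle: a (finite) 1-pseudomanifold. -/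
def Cycle (K : Complex α) : Prop := IsPM K 1

/-- A combinatorial 2-manifold: a weak 2-pseudomanifold all whose vertex
links are cycles. -/
def Comb2Mfd (K : Complex α) : Prop :=
  WeakPM K 2 ∧ ∀ v, ({v} : Finset α) ∈ K → Cycle (link K {v})

/-- The Euler characteristic `f₀ - f₁ + f₂` of a 2-dimensional complex. -/
def eulerChar (K : Complex α) : ℤ :=
  ((K.filter fun σ => σ.card = 1).card : ℤ) -
    ((K.filter fun σ => σ.card = 2).card : ℤ) +
    ((K.filter fun σ => σ.card = 3).card : ℤ)

/-- A combinatorial 2-sphere: a connected combinatorial 2-manifold with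
Euler characteristic 2. -/
def Comb2Sphere (K : Complex α) : Prop := Comb2Mfd K ∧ Conn K ∧ eulerChar K = 2

/-- A combinatorial 3-manifold: a 3-pseudomanifold all whose vertex links are
combinatorial 2-spheres. -/
def Comb3Mfd (K : Complex α) : Prop :=
  IsPM K 3 ∧ ∀ v, ({v} : Finset α) ∈ K → Comb2Sphere (link K {v})

end NPM

/-- The complex `S35` from the paper, generated by its facets. -/
def S35 : NPM.Complex ℕ :=
  NPM.genCx {{1,2,3,4}, {1,2,6,7}, {1,2,5,6}, {1,2,4,5}, {2,3,4,5}, {2,3,5,6}, {2,3,6,7}, {3,4,6,7}, {3,4,5,6}, {4,5,6,7}, {1,2,3,8}, {1,2,7,8}, {2,3,7,8}, {1,3,4,8}, {3,4,7,8}, {1,4,5,8}, {4,5,7,8}, {1,5,6,8}, {1,6,7,8}, {5,6,7,8}}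
/-- The complex `S36` from the paper, generated by its facets. -/
def S36 : NPM.Complex ℕ :=
  NPM.genCx {{1,2,3,4}, {1,2,5,6}, {1,2,4,5}, {1,5,6,7}, {2,3,4,5}, {2,3,5,6}, {2,3,6,7}, {3,4,6,7}, {3,4,5,6}, {4,5,6,7}, {1,2,6,8}, {1,6,7,8}, {2,6,7,8}, {1,2,3,8}, {2,3,7,8}, {1,3,4,8}, {3,4,7,8}, {1,4,5,8}, {1,5,7,8}, {4,5,7,8}}
/-- The complex `S37` from the paper, generated by its facets. -/
def S37 : NPM.Complex ℕ :=
  NPM.genCx {{1,2,3,4}, {1,2,5,6}, {1,2,4,5}, {1,4,5,7}, {2,3,4,5}, {2,3,5,6}, {2,3,6,7}, {3,4,6,7}, {3,4,5,6}, {4,5,6,7}, {1,5,6,8}, {1,5,7,8}, {5,6,7,8}, {1,2,6,8}, {2,6,7,8}, {1,2,3,8}, {2,3,7,8}, {1,3,4,8}, {1,4,7,8}, {3,4,7,8}}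
/-- The complex `S38` from the paper, generated by its facets. -/
def S38 : NPM.Complex ℕ :=
  NPM.genCx {{1,2,3,4}, {1,2,3,7}, {1,2,6,7}, {1,3,4,7}, {1,5,6,7}, {2,3,4,5}, {2,3,6,7}, {3,4,6,7}, {3,4,5,6}, {4,5,6,7}, {2,3,5,8}, {2,3,6,8}, {3,5,6,8}, {1,2,6,8}, {1,5,6,8}, {1,2,4,8}, {2,4,5,8}, {1,4,7,8}, {1,5,7,8}, {4,5,7,8}}

namespace NPM

variable {α : Type*} [DecidableEq α]

theorem mem_genCx {F : Finset (Finset α)} {τ : Finset α} :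
    τ ∈ genCx F ↔ τ.Nonempty ∧ ∃ σ ∈ F, τ ⊆ σ := by
  simp only [genCx, Finset.mem_biUnion, Finset.mem_filter, Finset.mem_powerset]
  tauto

theorem stdSphere_eq_genCx (B : Finset α) : stdSphere B = genCx (B.image B.erase) := by
  ext τ
  simp only [stdSphere, mem_genCx, Finset.mem_filter, Finset.mem_powerset,
    Finset.exists_mem_image, Finset.subset_erase]
  constructor
  · rintro ⟨hτ, hne, hB⟩
    obtain ⟨v, hv, hvτ⟩ := Finset.exists_of_ssubset (hτ.ssubset_of_ne hB)
    exact ⟨hne, v, hv, hτ, hvτ⟩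
  · rintro ⟨hne, v, hv, hτ, hvτ⟩
    exact ⟨hτ, hne, fun h => hvτ (h ▸ hv)⟩

theorem link_genCx (F : Finset (Finset α)) (A : Finset α) :
    link (genCx F) A = genCx ((F.filter (A ⊆ ·)).image (· \ A)) := by
  ext τ
  simp only [link, mem_genCx, Finset.mem_filter, Finset.exists_mem_image, Finset.subset_sdiff,
    Finset.union_subset_iff]
  constructor
  · rintro ⟨⟨hne, -⟩, hd, -, σ, hσ, hA, hτ⟩
    exact ⟨hne, σ, ⟨hσ, hA⟩, hτ, hd⟩
  · rintro ⟨hne, σ, ⟨hσ, hA⟩, hτ, hd⟩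
    exact ⟨⟨hne, σ, hσ, hτ⟩, hd, hne.mono Finset.subset_union_right, σ, hσ, hA, hτ⟩

theorem facets_genCx {F : Finset (Finset α)} {d : ℕ} (hF : ∀ σ ∈ F, σ.card = d + 1) :
    facets (genCx F) d = F := by
  ext τ
  simp only [facets, mem_genCx, Finset.mem_filter]
  constructor
  · rintro ⟨⟨-, σ, hσ, hτ⟩, hc⟩
    rwa [Finset.eq_of_subset_of_card_le hτ (by rw [hF σ hσ, hc])]
  · intro hτ
    have hc := hF τ hτ
    exact ⟨⟨Finset.card_pos.mp (by omega), τ, hτ, subset_rfl⟩, hc⟩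

/-- The facets after exchanging the star of `A` for the sets `(B ∪ A) \ {v}`, `v ∈ A`. -/
def flip (F : Finset (Finset α)) (A B : Finset α) : Finset (Finset α) :=
  F.filter (fun σ => ¬ A ⊆ σ) ∪ A.image fun v => (B ∪ A).erase v

/-- The facet family `F` of a `d`-dimensional complex admits the bistellar move exchanging
`A` for `B`. -/
def Flippable (d : ℕ) (F : Finset (Finset α)) (A B : Finset α) : Prop :=
  (∀ σ ∈ F, σ.card = d + 1) ∧ A.Nonempty ∧ 2 ≤ B.card ∧ A.card + B.card = d + 2 ∧
    (∃ σ ∈ F, A ⊆ σ) ∧ (∀ σ ∈ F, ¬ B ⊆ σ) ∧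
    (F.filter (A ⊆ ·)).image (· \ A) = B.image B.erase

instance (d : ℕ) (F : Finset (Finset α)) (A B : Finset α) : Decidable (Flippable d F A B) := by
  unfold Flippable
  infer_instance

theorem Flippable.bStep {d : ℕ} {F : Finset (Finset α)} {A B : Finset α}
    (h : Flippable d F A B) : BStep d (genCx F) (genCx (flip F A B)) := by
  obtain ⟨hF, hA, hB, hAB, hAF, hBF, hlk⟩ := h
  have hpos := hA.card_pos
  refine Or.inr ⟨B.card - 1, by omega, by omega, A, B, mem_genCx.mpr ⟨hA, hAF⟩, by omega,
    by omega, ?_, ?_, ?_⟩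
  · intro hmem
    obtain ⟨-, σ, hσ, hBσ⟩ := mem_genCx.mp hmem
    exact hBF σ hσ hBσ
  · rw [link_genCx, hlk, stdSphere_eq_genCx]
  · rw [facets_genCx hF, flip]

/-- Performing the moves in the list, in order, is possible starting from the facets `F`, and
ends at the facets of the standard sphere on `C`. -/
def flipsTo (d : ℕ) (C : Finset α) :
    List (Finset α × Finset α) → Finset (Finset α) → Bool
  | [], F => decide (F = C.image C.erase)
  | (A, B) :: l, F => decide (Flippable d F A B) && flipsTo d C l (flip F A B)

theorem bEquiv_of_flipsTo {d : ℕ} {C : Finset α} {l : List (Finset α × Finset α)}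
    {F : Finset (Finset α)} (h : flipsTo d C l F = true) :
    BEquiv d (genCx F) (stdSphere C) := by
  induction l generalizing F with
  | nil =>
    rw [stdSphere_eq_genCx, ← of_decide_eq_true h]
    exact Relation.ReflTransGen.refl
  | cons p l ih =>
    simp only [flipsTo, Bool.and_eq_true, decide_eq_true_eq] at h
    exact Relation.ReflTransGen.head h.1.bStep (ih h.2)

end NPM

/-- each of `S^3_{8,35}, …, S^3_{8,38}` is bistellar equivalent
to a standard 3-sphere (all nonempty proper subsets of a 5-element set). -/
theorem statement6 :
    ∀ X ∈ ([S35, S36, S37, S38] : List (NPM.Complex ℕ)),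
      ∃ B : Finset ℕ, B.card = 5 ∧ NPM.BEquiv 3 X (NPM.stdSphere B) := by
  simp only [List.forall_mem_cons, List.not_mem_nil, false_imp_iff, implies_true, and_true]
  refine ⟨?_, ?_, ?_, ?_⟩
  · exact ⟨{1, 3, 5, 6, 7}, rfl, NPM.bEquiv_of_flipsTo
      (l := [({2, 8}, {1, 3, 7}), ({2, 4}, {1, 3, 5}), ({3, 8}, {1, 4, 7}), ({2, 7}, {1, 3, 6}),
      ({2}, {1, 3, 5, 6}), ({4, 6}, {3, 5, 7}), ({3, 4}, {1, 5, 7}),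
      ({4}, {1, 5, 7, 8}), ({8}, {1, 5, 6, 7})])
      (by decide +kernel)⟩
  · exact ⟨{3, 5, 6, 7, 8}, rfl, NPM.bEquiv_of_flipsTo
      (l := [({2, 4}, {1, 3, 5}), ({2, 7}, {3, 6, 8}), ({2, 8}, {1, 3, 6}), ({2}, {1, 3, 5, 6}),
      ({1, 4}, {3, 5, 8}), ({4, 6}, {3, 5, 7}), ({4}, {3, 5, 7, 8}),
      ({1, 7}, {5, 6, 8}), ({1}, {3, 5, 6, 8})])
      (by decide +kernel)⟩
  · exact ⟨{3, 5, 6, 7, 8}, rfl, NPM.bEquiv_of_flipsTo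
      (l := [({2, 4}, {1, 3, 5}), ({2, 7}, {3, 6, 8}), ({2, 8}, {1, 3, 6}), ({2}, {1, 3, 5, 6}),
      ({4, 6}, {3, 5, 7}), ({4, 5}, {1, 3, 7}), ({4}, {1, 3, 7, 8}),
      ({1, 7}, {3, 5, 8}), ({1}, {3, 5, 6, 8})])
      (by decide +kernel)⟩
  · exact ⟨{1, 3, 5, 6, 7}, rfl, NPM.bEquiv_of_flipsTo
      (l := [({7, 8}, {1, 4, 5}), ({3, 8}, {2, 5, 6}), ({2, 7}, {1, 3, 6}), ({4, 8}, {1, 2, 5}),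
      ({8}, {1, 2, 5, 6}), ({4, 6}, {3, 5, 7}), ({2, 6}, {1, 3, 5}),
      ({2}, {1, 3, 4, 5}), ({4}, {1, 3, 5, 7})])
      (by decide +kernel)⟩
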